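/- Let u, v : ℝ² → ℂ be continuously differentiable, let λ ∈ ℂ∖{0}, and set z := λ². If φ : ℝ² → M₂(ℂ) is differentiable and satisfies the λ-Lax pair ∂_x φ − (i/4)(λ²−λ⁻²)[σ₃,φ] = Q(x,t,λ)φ and ∂_t φ − (i/4)(λ²+λ⁻²)[σ₃,φ] = P(x,t,λ)φ, then the gauge-transformed function Ψ(x,t) := 𝒯(x,t)φ(x,t), where 𝒯(x,t) := [[1,0],[v(x,t), λ]], satisfies the z-Lax pair ∂_x Ψ − (i/4)(z−z⁻¹)[σ₃,Ψ] = 𝒰(x,t,z)Ψ and ∂_t Ψ − (i/4)(z+z⁻¹)[σ₃,Ψ] = 𝒱(x,t,z)Ψ. -/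

import Mathlib

open Complex Matrix

noncomputable section

abbrev M2 : Type := Matrix (Fin 2) (Fin 2) ℂ

/-- partial derivative in `x` (first coordinate). -/
def pdx (f : ℝ × ℝ → ℂ) (p : ℝ × ℝ) : ℂ := fderiv ℝ f p (1, 0)

/-- partial derivative in `t` (second coordinate). -/
def pdt (f : ℝ × ℝ → ℂ) (p : ℝ × ℝ) : ℂ := fderiv ℝ f p (0, 1)

/-- entrywise partial derivative in `x` of a matrix-valued function. -/
def Mdx (M : ℝ × ℝ → M2) (p : ℝ × ℝ) : M2 := Matrix.of fun i j => pdx (fun q => M q i j) p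

/-- entrywise partial derivative in `t` of a matrix-valued function. -/
def Mdt (M : ℝ × ℝ → M2) (p : ℝ × ℝ) : M2 := Matrix.of fun i j => pdt (fun q => M q i j) p

def sigma3 : M2 := !![1, 0; 0, -1]

/-- matrix commutator. -/
def mcomm (A B : M2) : M2 := A * B - B * A

/-- `|w|²` as a complex number. -/
def nsq (w : ℂ) : ℂ := (Complex.normSq w : ℂ)

/-- complex conjugation. -/
def cj (w : ℂ) : ℂ := (starRingEnd ℂ) w

/-- the massive Thirring system. -/
def MTsys (u v : ℝ × ℝ → ℂ) : Prop :=
  ∀ p : ℝ × ℝ,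
    Complex.I * (pdt u p + pdx u p) + v p + nsq (v p) * u p = 0 ∧
    Complex.I * (pdt v p - pdx v p) + u p + nsq (u p) * v p = 0

/-- the matrix `Q(x,t,λ)` of the λ-Lax pair. -/
def Qmat (u v : ℝ × ℝ → ℂ) (l : ℂ) (p : ℝ × ℝ) : M2 :=
  (Complex.I / 4 * (nsq (u p) - nsq (v p))) • sigma3
    - (Complex.I * l / 2) • !![0, cj (v p); v p, 0]
    + (Complex.I / (2 * l)) • !![0, cj (u p); u p, 0]

/-- the matrix `P(x,t,λ)` of the λ-Lax pair. -/
def Pmat (u v : ℝ × ℝ → ℂ) (l : ℂ) (p : ℝ × ℝ) : M2 :=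
  (-(Complex.I / 4) * (nsq (u p) + nsq (v p))) • sigma3
    - (Complex.I * l / 2) • !![0, cj (v p); v p, 0]
    - (Complex.I / (2 * l)) • !![0, cj (u p); u p, 0]

def cU1m (u v : ℝ × ℝ → ℂ) (p : ℝ × ℝ) : M2 :=
  !![(Complex.I/4) * (nsq (u p) + nsq (v p)), -(Complex.I/2) * cj (v p);
     pdx v p + (Complex.I/2) * nsq (u p) * v p + (Complex.I/2) * u p,
     -((Complex.I/4) * (nsq (u p) + nsq (v p)))]

def cU2m (u v : ℝ × ℝ → ℂ) (p : ℝ × ℝ) : M2 :=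
  !![cj (u p) * v p, -cj (u p);
     v p + cj (u p) * (v p)^2, -(cj (u p) * v p)]

def cV1m (u v : ℝ × ℝ → ℂ) (p : ℝ × ℝ) : M2 :=
  !![-(Complex.I/4) * (nsq (u p) - nsq (v p)), -(Complex.I/2) * cj (v p);
     pdt v p - (Complex.I/2) * nsq (u p) * v p - (Complex.I/2) * u p,
     (Complex.I/4) * (nsq (u p) - nsq (v p))]

/-- the matrix `𝒰(x,t,z)` of the z-Lax pair. -/
def cUmat (u v : ℝ × ℝ → ℂ) (z : ℂ) (p : ℝ × ℝ) : M2 :=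
  cU1m u v p - (Complex.I/(2*z)) • cU2m u v p

/-- the matrix `𝒱(x,t,z)` of the z-Lax pair. -/
def cVmat (u v : ℝ × ℝ → ℂ) (z : ℂ) (p : ℝ × ℝ) : M2 :=
  cV1m u v p + (Complex.I/(2*z)) • cU2m u v p

lemma fd_aux (f g h : ℝ × ℝ → ℂ) (l : ℂ) (p w : ℝ × ℝ) (hf : Differentiable ℝ f)
    (hg : Differentiable ℝ g) (hh : Differentiable ℝ h) :
    fderiv ℝ (fun q => f q * g q + l * h q) p w
      = fderiv ℝ f p w * g p + f p * fderiv ℝ g p w + l * fderiv ℝ h p w := by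
  have h1 := ((hf p).hasFDerivAt.mul (hg p).hasFDerivAt).add ((hh p).hasFDerivAt.const_mul l)
  have h2 : fderiv ℝ (fun q => f q * g q + l * h q) p = _ := h1.fderiv
  rw [h2]
  simp
  ring

lemma nsq_eq (w : ℂ) : nsq w = w * cj w := by
  simp [nsq, cj, Complex.mul_conj]

/-- the gauge transformation `Ψ = 𝒯 φ`, `𝒯 = [[1,0],[v,λ]]`, maps
solutions of the λ-Lax pair to solutions of the z-Lax pair with `z = λ²`. -/
theorem gauge_lambda_to_z
    (u v : ℝ × ℝ → ℂ) (hu : ContDiff ℝ 1 u) (hv : ContDiff ℝ 1 v)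
    (l : ℂ) (hl : l ≠ 0) (φ : ℝ × ℝ → M2)
    (hφ : ∀ i j, Differentiable ℝ fun p => φ p i j)
    (hLx : ∀ p : ℝ × ℝ,
      Mdx φ p - (Complex.I / 4 * (l ^ 2 - (l ^ 2)⁻¹)) • mcomm sigma3 (φ p)
        = Qmat u v l p * φ p)
    (hLt : ∀ p : ℝ × ℝ,
      Mdt φ p - (Complex.I / 4 * (l ^ 2 + (l ^ 2)⁻¹)) • mcomm sigma3 (φ p)
        = Pmat u v l p * φ p) :
    let z : ℂ := l ^ 2
    let Ψ : ℝ × ℝ → M2 := fun q => !![1, 0; v q, l] * φ q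
    (∀ p : ℝ × ℝ,
        Mdx Ψ p - (Complex.I / 4 * (z - z⁻¹)) • mcomm sigma3 (Ψ p)
          = cUmat u v z p * Ψ p) ∧
    (∀ p : ℝ × ℝ,
        Mdt Ψ p - (Complex.I / 4 * (z + z⁻¹)) • mcomm sigma3 (Ψ p)
          = cVmat u v z p * Ψ p) := by
  have hvd : Differentiable ℝ v := hv.differentiable (by norm_num)
  intro z Ψ
  simp only [z, Ψ]
  constructor
  · intro p
    have e := hLx p
    have e00 := congrFun (congrFun e 0) 0
    have e01 := congrFun (congrFun e 0) 1
    have e10 := congrFun (congrFun e 1) 0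
    have e11 := congrFun (congrFun e 1) 1
    simp [Mdx, mcomm, sigma3, Qmat, Matrix.mul_apply, Matrix.vecMul, dotProduct, Fin.sum_univ_two, pdx, nsq_eq] at e00 e01 e10 e11
    rw [sub_eq_iff_eq_add] at e01 e10
    ext i j
    fin_cases i <;> fin_cases j <;>
      simp [Mdx, mcomm, sigma3, cUmat, cU1m, cU2m, Matrix.mul_apply, Matrix.vecMul, dotProduct, Fin.sum_univ_two, pdx, nsq_eq,
        fd_aux _ _ _ l p _ hvd (hφ 0 0) (hφ 1 0), fd_aux _ _ _ l p _ hvd (hφ 0 1) (hφ 1 1),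
        e00, e01, e10, e11] <;>
      field_simp <;> ring
  · intro p
    have e := hLt p
    have e00 := congrFun (congrFun e 0) 0
    have e01 := congrFun (congrFun e 0) 1
    have e10 := congrFun (congrFun e 1) 0
    have e11 := congrFun (congrFun e 1) 1
    simp [Mdt, mcomm, sigma3, Pmat, Matrix.mul_apply, Matrix.vecMul, dotProduct, Fin.sum_univ_two, pdt, nsq_eq] at e00 e01 e10 e11
    rw [sub_eq_iff_eq_add] at e01 e10
    ext i j
    fin_cases i <;> fin_cases j <;>
      simp [Mdt, mcomm, sigma3, cVmat, cV1m, cU2m, Matrix.mul_apply, Matrix.vecMul, dotProduct, Fin.sum_univ_two, pdt, nsq_eq,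
        fd_aux _ _ _ l p _ hvd (hφ 0 0) (hφ 1 0), fd_aux _ _ _ l p _ hvd (hφ 0 1) (hφ 1 1),
        e00, e01, e10, e11] <;>
      field_simp <;> ring
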